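/- Let V₂₅ ⊂ ℝ³ be the set of 25 directions given (up to scaling) by: (1,0,0), (0,1,0), (0,0,1); (0,1,1), (0,1,−1), (1,0,1), (1,0,−1), (1,1,0), (1,−1,0); (1,1,1), (−1,1,1), (1,−1,1), (1,1,−1); and the twelve vectors (1,1,2), (1,−1,2), (−1,1,2), (−1,−1,2), (1,2,1), (1,2,−1), (−1,2,1), (−1,2,−1), (2,1,1), (2,1,−1), (2,−1,1), (2,−1,−1). Then V₂₅ is closed under forming triads: for any two orthogonal vectors u, v ∈ V₂₅, the unique direction orthogonal to both u and v (the span of the cross product u × v) is the span of some vector of V₂₅. -/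

import Mathlib

open Matrix

/-- The 25 directions of the completed Yu–Oh set: the 13 Yu–Oh directions together with,
for every orthogonal pair among them, the unique third direction completing it to an
orthogonal triple. -/
def V25 : Set (Fin 3 → ℝ) :=
  {![1, 0, 0], ![0, 1, 0], ![0, 0, 1],
   ![0, 1, 1], ![0, 1, -1], ![1, 0, 1], ![1, 0, -1], ![1, 1, 0], ![1, -1, 0],
   ![1, 1, 1], ![-1, 1, 1], ![1, -1, 1], ![1, 1, -1],
   ![1, 1, 2], ![1, -1, 2], ![-1, 1, 2], ![-1, -1, 2],
   ![1, 2, 1], ![1, 2, -1], ![-1, 2, 1], ![-1, 2, -1],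
   ![2, 1, 1], ![2, 1, -1], ![2, -1, 1], ![2, -1, -1]}

/-- Integer representatives of the directions in `V25`. -/
def intV25 : List (Fin 3 → ℤ) :=
  [![1, 0, 0], ![0, 1, 0], ![0, 0, 1],
   ![0, 1, 1], ![0, 1, -1], ![1, 0, 1], ![1, 0, -1], ![1, 1, 0], ![1, -1, 0],
   ![1, 1, 1], ![-1, 1, 1], ![1, -1, 1], ![1, 1, -1],
   ![1, 1, 2], ![1, -1, 2], ![-1, 1, 2], ![-1, -1, 2],
   ![1, 2, 1], ![1, 2, -1], ![-1, 2, 1], ![-1, 2, -1],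
   ![2, 1, 1], ![2, 1, -1], ![2, -1, 1], ![2, -1, -1]]

theorem exists_smul_eq_cross_of_mem_intV25 :
    ∀ u ∈ intV25, ∀ v ∈ intV25, u ⬝ᵥ v = 0 →
      ∃ w ∈ intV25, ∃ k ∈ [1, -1, 2, -2, 3, -3], k • w = crossProduct u v := by
  decide +kernel

theorem intCast_comp_vec3 (a b c : ℤ) :
    ((↑) : ℤ → ℝ) ∘ ![a, b, c] = ![(a : ℝ), (b : ℝ), (c : ℝ)] := by
  ext i
  fin_cases i <;> rfl

theorem mem_V25_iff {u : Fin 3 → ℝ} : u ∈ V25 ↔ ∃ a ∈ intV25, ((↑) : ℤ → ℝ) ∘ a = u := by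
  simp [V25, intV25, intCast_comp_vec3, eq_comm]

theorem intCast_comp_cross (a b : Fin 3 → ℤ) :
    ((↑) : ℤ → ℝ) ∘ crossProduct a b = crossProduct (((↑) : ℤ → ℝ) ∘ a) ((↑) ∘ b) := by
  simp [cross_apply, intCast_comp_vec3]

/-- The completed Yu–Oh set `V₂₅` is closed under forming triads: for
any two orthogonal vectors `u, v ∈ V₂₅`, the unique direction orthogonal to both (the
span of the cross product `u ×₃ v`) is the span of some vector of `V₂₅`. -/
theorem yuOh25_closed_under_triads :
    ∀ u ∈ V25, ∀ v ∈ V25, u ⬝ᵥ v = 0 →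
      ∃ w ∈ V25, Submodule.span ℝ {w} = Submodule.span ℝ {crossProduct u v} := by
  intro u hu v hv huv
  obtain ⟨a, ha, rfl⟩ := mem_V25_iff.mp hu
  obtain ⟨b, hb, rfl⟩ := mem_V25_iff.mp hv
  have hab : a ⬝ᵥ b = 0 := by
    have h := (RingHom.map_dotProduct (Int.castRingHom ℝ) a b).trans huv
    exact Int.cast_eq_zero.mp h
  obtain ⟨w, hw, k, hk, hkw⟩ := exists_smul_eq_cross_of_mem_intV25 a ha b hb hab
  have hk0 : (k : ℝ) ≠ 0 := by
    rw [Int.cast_ne_zero]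
    rintro rfl
    simp at hk
  refine ⟨(↑) ∘ w, mem_V25_iff.mpr ⟨w, hw, rfl⟩, ?_⟩
  have hcross : crossProduct (((↑) : ℤ → ℝ) ∘ a) ((↑) ∘ b) = (k : ℝ) • ((↑) : ℤ → ℝ) ∘ w := by
    rw [← intCast_comp_cross, ← hkw]
    ext i
    simp
  rw [hcross, Submodule.span_singleton_smul_eq hk0.isUnit]
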